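/- Let A > 0, B > 0 and T > R > 1 be real constants and let the exponents a,b,c,x,y,z,p satisfy condition (E) together with z ≥ 0. Define recursively, for j ≥ 0: b_0 = b, b_{j+1} = p·b_j − x; c_0 = c, c_{j+1} = p·c_j + z + 1; R_0 = R, R_{j+1} = (1+2^{−j})·R_j; A_0 = A, A_{j+1} = 2^{−j}·A_j^p·B / ((1+2^{−j})·(p·c_j + z + 1)). If a continuous function H : [R,T) → ℝ satisfies the system (NII), then for every j ≥ 0 and every t ∈ [R_j, T): H(t) ≥ A_j · t^a · (log t)^{−b_j} · (log(t/R_j))^{c_j}. -/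

import Mathlib

open Real MeasureTheory

/-- The exponent `c` cannot be negative: otherwise `H` would blow up at `R`. -/
lemma c_nonneg_aux (A T R a b c : ℝ) (hA : 0 < A) (hR : 1 < R) (hT : R < T)
    (H : ℝ → ℝ) (hHc : ContinuousOn H (Set.Ico R T))
    (hH1 : ∀ t ∈ Set.Ico R T,
      A * t ^ a * (Real.log t) ^ (-b) * (Real.log (t / R)) ^ c ≤ H t) : 0 ≤ c := by
  by_contra hc
  push Not at hc
  have hR0 : 0 < R := by linarith
  have hlog : 0 < Real.log R := Real.log_pos hR
  have hle : nhdsWithin R (Set.Ioo R T) = nhdsWithin R (Set.Ioi R) := nhdsWithin_Ioo_eq_nhdsGT hT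
  have h1 : Filter.Tendsto H (nhdsWithin R (Set.Ioi R)) (nhds (H R)) := by
    rw [← hle]
    exact (hHc R ⟨le_refl _, hT⟩).mono_left (nhdsWithin_mono _ Set.Ioo_subset_Ico_self)
  have h2 : Filter.Tendsto (fun t => A * t ^ a * (Real.log t) ^ (-b))
      (nhdsWithin R (Set.Ioi R)) (nhds (A * R ^ a * (Real.log R) ^ (-b))) := by
    have : ContinuousAt (fun t => A * t ^ a * (Real.log t) ^ (-b)) R := by
      refine ContinuousAt.mul (ContinuousAt.mul continuousAt_const ?_) ?_
      · exact Real.continuousAt_rpow_const _ _ (Or.inl hR0.ne')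
      · exact (Real.continuousAt_log hR0.ne').rpow_const (Or.inl hlog.ne')
    exact this.tendsto.mono_left nhdsWithin_le_nhds
  have h3 : Filter.Tendsto (fun t => Real.log (t / R)) (nhdsWithin R (Set.Ioi R))
      (nhdsWithin 0 (Set.Ioi 0)) := by
    rw [tendsto_nhdsWithin_iff]
    constructor
    · have : ContinuousAt (fun t => Real.log (t / R)) R := by
        refine ContinuousAt.log (by fun_prop) ?_
        simp [hR0.ne']
      have h := this.tendsto
      simp only [div_self hR0.ne', Real.log_one] at h
      exact h.mono_left nhdsWithin_le_nhds
    · filter_upwards [self_mem_nhdsWithin] with t ht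
      exact Real.log_pos ((one_lt_div hR0).2 ht)
  have h4 := (tendsto_rpow_neg_nhdsGT_zero hc).comp h3
  have h5 := h2.pos_mul_atTop (by positivity) h4
  refine not_tendsto_nhds_of_tendsto_atTop (Filter.tendsto_atTop_mono' _ ?_ h5) _ h1
  rw [← hle]
  filter_upwards [self_mem_nhdsWithin] with t ht
  exact hH1 t ⟨ht.1.le, ht.2⟩

lemma inner_integral_aux (ρ s m : ℝ) (hρ : 0 < ρ) (hs : ρ ≤ s) (hm : 0 ≤ m) :
    ∫ r in ρ..s, r⁻¹ * (Real.log (r / ρ)) ^ m = (Real.log (s / ρ)) ^ (m + 1) / (m + 1) := by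
  have hd : ∀ r ∈ Set.uIcc ρ s, HasDerivAt (fun r => (Real.log (r / ρ)) ^ (m + 1) / (m + 1))
      (r⁻¹ * (Real.log (r / ρ)) ^ m) r := by
    intro r hr
    rw [Set.uIcc_of_le hs] at hr
    have hr0 : 0 < r := lt_of_lt_of_le hρ hr.1
    have h1 : HasDerivAt (fun r => Real.log (r / ρ)) r⁻¹ r := by
      have := ((hasDerivAt_id r).div_const ρ).log (by simp; exact ⟨hr0.ne', hρ.ne'⟩)
      refine HasDerivAt.congr_deriv this ?_
      change 1 / ρ / (r / ρ) = r⁻¹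
      field_simp
    have h2 := (h1.rpow_const (p := m + 1) (Or.inr (by linarith))).div_const (m + 1)
    refine HasDerivAt.congr_deriv h2 ?_
    have : m + 1 ≠ 0 := by linarith
    rw [show m + 1 - 1 = m by ring]
    field_simp
  rw [intervalIntegral.integral_eq_sub_of_hasDerivAt hd]
  · simp [hρ.ne', Real.zero_rpow (by linarith : m + 1 ≠ 0)]
  · apply ContinuousOn.intervalIntegrable
    rw [Set.uIcc_of_le hs]
    intro r hr
    have hr0 : 0 < r := lt_of_lt_of_le hρ hr.1
    refine ContinuousWithinAt.mul (continuousAt_inv₀ hr0.ne').continuousWithinAt ?_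
    refine ContinuousWithinAt.rpow_const ?_ (Or.inr hm)
    refine ContinuousAt.continuousWithinAt (ContinuousAt.log (by fun_prop) ?_)
    positivity

lemma step_aux (B T R a x y z p : ℝ)
    (hB : 0 < B) (hR : 1 < R)
    (hp : 1 < p) (ha : a ≤ 1)
    (hy : y + p * a = -1)
    (hz0 : 0 ≤ z)
    (H : ℝ → ℝ) (hHc : ContinuousOn H (Set.Ico R T))
    (hH2 : ∀ t ∈ Set.Ico R T,
      B * (Real.log t) ^ x *
        ∫ s in R..t, ∫ r in R..s, r ^ y * (Real.log (r / R)) ^ z * |H r| ^ p ≤ H t)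
    (ε ρ α β γ : ℝ) (hε : 0 < ε) (hρ : R ≤ ρ) (hα : 0 < α) (hβ : 0 ≤ β) (hγ : 0 ≤ γ)
    (hH : ∀ t ∈ Set.Ico ρ T,
      α * t ^ a * (Real.log t) ^ (-β) * (Real.log (t / ρ)) ^ γ ≤ H t)
    (t : ℝ) (ht : t ∈ Set.Ico ((1 + ε) * ρ) T) :
    ε * α ^ p * B / ((1 + ε) * (p * γ + z + 1)) * t ^ a * (Real.log t) ^ (-(p * β - x)) *
      (Real.log (t / ((1 + ε) * ρ))) ^ (p * γ + z + 1) ≤ H t := by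
  obtain ⟨ht1, htT⟩ := ht
  have hR0 : 0 < R := by linarith
  have hρ0 : 0 < ρ := by linarith
  have hρt : ρ ≤ t := by nlinarith
  have hRt : R ≤ t := hρ.trans hρt
  have ht0 : 0 < t := by linarith
  have hlt : 0 < Real.log t := Real.log_pos (by linarith)
  have hpγ : 0 ≤ p * γ := by positivity
  have hm : 0 ≤ p * γ + z := by positivity
  set g : ℝ → ℝ := fun r => r ^ y * (Real.log (r / R)) ^ z * |H r| ^ p with hg
  have hgc : ContinuousOn g (Set.Icc R t) := by
    have hH' : ContinuousOn H (Set.Icc R t) := hHc.mono (fun r hr => ⟨hr.1, hr.2.trans_lt htT⟩)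
    refine ContinuousOn.mul (ContinuousOn.mul ?_ ?_) ?_
    · exact continuousOn_id.rpow_const
        (fun r hr => Or.inl (ne_of_gt (lt_of_lt_of_le hR0 hr.1)))
    · refine ContinuousOn.rpow_const ?_ (fun r _ => Or.inr hz0)
      refine ContinuousOn.log (by fun_prop) ?_
      intro r hr
      have : 0 < r := lt_of_lt_of_le hR0 hr.1
      positivity
    · exact hH'.abs.rpow_const (fun r _ => Or.inr (by linarith))
  have hg0 : ∀ r, R ≤ r → 0 ≤ g r := by
    intro r hr
    have : 0 < r := lt_of_lt_of_le hR0 hr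
    have h1 : 0 ≤ Real.log (r / R) := Real.log_nonneg ((one_le_div hR0).2 hr)
    positivity
  have hgi : ∀ u v, R ≤ u → u ≤ v → v ≤ t → IntervalIntegrable g volume u v := by
    intro u v hu huv hv
    apply ContinuousOn.intervalIntegrable
    rw [Set.uIcc_of_le huv]
    exact hgc.mono (Set.Icc_subset_Icc hu hv)
  -- pointwise lower bound for g
  set K : ℝ := α ^ p * (Real.log t) ^ (-(p * β)) with hK
  have hK0 : 0 < K := by positivity
  have hglow : ∀ r, ρ ≤ r → r ≤ t → K * (r⁻¹ * (Real.log (r / ρ)) ^ (p * γ + z)) ≤ g r := by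
    intro r hr hrt
    have hr0 : 0 < r := lt_of_lt_of_le hρ0 hr
    have hlr : 0 < Real.log r := Real.log_pos (by linarith)
    have hL : 0 ≤ Real.log (r / ρ) := Real.log_nonneg ((one_le_div hρ0).2 hr)
    have hLL : Real.log (r / ρ) ≤ Real.log (r / R) := by
      apply Real.log_le_log (by positivity)
      gcongr
    have h1 : α * r ^ a * (Real.log t) ^ (-β) * (Real.log (r / ρ)) ^ γ ≤ |H r| := by
      refine le_trans ?_ ((hH r ⟨hr, hrt.trans_lt htT⟩).trans (le_abs_self _))
      have : (Real.log t) ^ (-β) ≤ (Real.log r) ^ (-β) :=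
        Real.rpow_le_rpow_of_nonpos hlr (Real.log_le_log hr0 hrt) (by linarith)
      gcongr
    have h2 : (α * r ^ a * (Real.log t) ^ (-β) * (Real.log (r / ρ)) ^ γ) ^ p ≤ |H r| ^ p :=
      Real.rpow_le_rpow (by positivity) h1 (by linarith)
    have h3 : (Real.log (r / ρ)) ^ z ≤ (Real.log (r / R)) ^ z := Real.rpow_le_rpow hL hLL hz0
    have h4 : (α * r ^ a * (Real.log t) ^ (-β) * (Real.log (r / ρ)) ^ γ) ^ p
        = K * r ^ (p * a) * (Real.log (r / ρ)) ^ (p * γ) := by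
      rw [Real.mul_rpow (by positivity) (by positivity),
        Real.mul_rpow (by positivity) (by positivity),
        Real.mul_rpow (by positivity) (by positivity), ← Real.rpow_mul hr0.le,
        ← Real.rpow_mul hlt.le, ← Real.rpow_mul hL, hK]
      rw [show a * p = p * a by ring, show -β * p = -(p * β) by ring, show γ * p = p * γ by ring]
      ring
    have h5 : r⁻¹ = r ^ y * r ^ (p * a) := by
      rw [← Real.rpow_add hr0, hy, Real.rpow_neg_one]
    have h6 : (Real.log (r / ρ)) ^ (p * γ + z)
        = (Real.log (r / ρ)) ^ (p * γ) * (Real.log (r / ρ)) ^ z :=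
      Real.rpow_add_of_nonneg hL hpγ hz0
    have h7 : 0 ≤ Real.log (r / R) := hL.trans hLL
    calc K * (r⁻¹ * (Real.log (r / ρ)) ^ (p * γ + z))
        = r ^ y * (Real.log (r / ρ)) ^ z *
          (α * r ^ a * (Real.log t) ^ (-β) * (Real.log (r / ρ)) ^ γ) ^ p := by
          rw [h4, h5, h6]; ring
      _ ≤ r ^ y * (Real.log (r / R)) ^ z * |H r| ^ p := by gcongr
  -- the inner integral
  set F : ℝ → ℝ := fun s => ∫ r in R..s, g r with hF
  have hFc : ContinuousOn F (Set.Icc R t) := by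
    have := intervalIntegral.continuousOn_primitive_interval (μ := volume) (f := g)
      (a := R) (b := t) (by
        rw [Set.uIcc_of_le hRt]; exact hgc.integrableOn_Icc)
    rwa [Set.uIcc_of_le hRt] at this
  have hF0 : ∀ s, R ≤ s → 0 ≤ F s := by
    intro s hs
    exact intervalIntegral.integral_nonneg hs (fun r hr => hg0 r hr.1)
  have hFlow : ∀ s, ρ ≤ s → s ≤ t →
      K * ((Real.log (s / ρ)) ^ (p * γ + z + 1) / (p * γ + z + 1)) ≤ F s := by
    intro s hs hst
    rw [← inner_integral_aux ρ s (p * γ + z) hρ0 hs hm, ← intervalIntegral.integral_const_mul]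
    have hsplit : F s = (∫ r in R..ρ, g r) + ∫ r in ρ..s, g r :=
      (intervalIntegral.integral_add_adjacent_intervals
        (hgi R ρ le_rfl hρ (hs.trans hst)) (hgi ρ s hρ hs hst)).symm
    have hn : 0 ≤ ∫ r in R..ρ, g r :=
      intervalIntegral.integral_nonneg hρ (fun r hr => hg0 r hr.1)
    have : ∫ r in ρ..s, K * (r⁻¹ * (Real.log (r / ρ)) ^ (p * γ + z)) ≤ ∫ r in ρ..s, g r := by
      refine intervalIntegral.integral_mono_on hs ?_ (hgi ρ s hρ hs hst)
        (fun r hr => hglow r hr.1 (hr.2.trans hst))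
      apply ContinuousOn.intervalIntegrable
      rw [Set.uIcc_of_le hs]
      intro r hr
      have hr0 : 0 < r := lt_of_lt_of_le hρ0 hr.1
      refine ContinuousWithinAt.mul continuousWithinAt_const
        (ContinuousWithinAt.mul (continuousAt_inv₀ hr0.ne').continuousWithinAt ?_)
      refine ContinuousWithinAt.rpow_const ?_ (Or.inr hm)
      refine ContinuousAt.continuousWithinAt (ContinuousAt.log (by fun_prop) ?_)
      positivity
    linarith
  -- the outer integral
  set q : ℝ := t / (1 + ε) with hq
  have hqρ : ρ ≤ q := by
    rw [hq, le_div_iff₀ (by linarith)]; linarith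
  have hqt : q ≤ t := div_le_self ht0.le (by linarith)
  have hq0 : 0 < q := by linarith
  have hFi : ∀ u v, R ≤ u → u ≤ v → v ≤ t → IntervalIntegrable F volume u v := by
    intro u v hu huv hv
    apply ContinuousOn.intervalIntegrable
    rw [Set.uIcc_of_le huv]
    exact hFc.mono (Set.Icc_subset_Icc hu hv)
  have hℓ : 0 ≤ Real.log (q / ρ) := Real.log_nonneg ((one_le_div hρ0).2 hqρ)
  set C : ℝ := K * ((Real.log (q / ρ)) ^ (p * γ + z + 1) / (p * γ + z + 1)) with hC
  have hout : (t - q) * C ≤ ∫ s in R..t, F s := by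
    have hsplit : ∫ s in R..t, F s = (∫ s in R..q, F s) + ∫ s in q..t, F s :=
      (intervalIntegral.integral_add_adjacent_intervals
        (hFi R q le_rfl (hρ.trans hqρ) hqt) (hFi q t (hρ.trans hqρ) hqt le_rfl)).symm
    have hn : 0 ≤ ∫ s in R..q, F s :=
      intervalIntegral.integral_nonneg (hρ.trans hqρ) (fun s hs => hF0 s hs.1)
    have h1 : ∫ s in q..t, C ≤ ∫ s in q..t, F s := by
      refine intervalIntegral.integral_mono_on hqt (by simp)
        (hFi q t (hρ.trans hqρ) hqt le_rfl) ?_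
      intro s hs
      refine le_trans ?_ (hFlow s (hqρ.trans hs.1) hs.2)
      rw [hC]
      have hlog : Real.log (q / ρ) ≤ Real.log (s / ρ) := by
        apply Real.log_le_log (by positivity)
        have := hs.1
        gcongr
      gcongr
    rw [intervalIntegral.integral_const, smul_eq_mul] at h1
    linarith
  have hmain := hH2 t ⟨hRt, htT⟩
  change B * (Real.log t) ^ x * (∫ s in R..t, F s) ≤ H t at hmain
  refine le_trans ?_ hmain
  refine le_trans ?_ (mul_le_mul_of_nonneg_left hout (by positivity))
  have e1 : t / ((1 + ε) * ρ) = q / ρ := by rw [hq, div_div]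
  have e2 : t - q = ε / (1 + ε) * t := by
    rw [hq]; field_simp; ring
  have e3 : (Real.log t) ^ (-(p * β - x)) = (Real.log t) ^ x * (Real.log t) ^ (-(p * β)) := by
    rw [← Real.rpow_add hlt]; congr 1; ring
  have e4 : t ^ a ≤ t := by
    calc t ^ a ≤ t ^ (1 : ℝ) := Real.rpow_le_rpow_of_exponent_le (by linarith) ha
      _ = t := Real.rpow_one t
  rw [e1, e2, e3]
  calc _ ≤ ε * α ^ p * B / ((1 + ε) * (p * γ + z + 1)) * t *
        ((Real.log t) ^ x * (Real.log t) ^ (-(p * β))) *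
        (Real.log (q / ρ)) ^ (p * γ + z + 1) := by gcongr
    _ = _ := by
      rw [hC, hK]
      have : p * γ + z + 1 ≠ 0 := by linarith
      have h' : 1 + ε ≠ 0 := by linarith
      field_simp

theorem iterated_lower_bounds
    (A B T R a b c x y z p : ℝ)
    (hA : 0 < A) (hB : 0 < B) (hR : 1 < R) (hT : R < T)
    -- condition (E)
    (hp : 1 < p) (ha : a ≤ 1) (hb : max 0 (x / (p - 1)) ≤ b)
    (hy : y + p * a = -1) (hz1 : -1 < z + c * p) (hz2 : c - 1 ≤ z + c * p)
    -- extra assumption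
    (hz0 : 0 ≤ z)
    -- the iteration sequences
    (bs cs Rs As : ℕ → ℝ)
    (hb0 : bs 0 = b) (hbrec : ∀ j, bs (j + 1) = p * bs j - x)
    (hc0 : cs 0 = c) (hcrec : ∀ j, cs (j + 1) = p * cs j + z + 1)
    (hR0 : Rs 0 = R) (hRrec : ∀ j : ℕ, Rs (j + 1) = (1 + (2 : ℝ) ^ (-(j : ℝ))) * Rs j)
    (hA0 : As 0 = A)
    (hArec : ∀ j : ℕ, As (j + 1) =
      (2 : ℝ) ^ (-(j : ℝ)) * As j ^ p * B / ((1 + (2 : ℝ) ^ (-(j : ℝ))) * (p * cs j + z + 1)))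
    -- the system (NII)
    (H : ℝ → ℝ) (hHc : ContinuousOn H (Set.Ico R T))
    (hH1 : ∀ t ∈ Set.Ico R T,
      A * t ^ a * (Real.log t) ^ (-b) * (Real.log (t / R)) ^ c ≤ H t)
    (hH2 : ∀ t ∈ Set.Ico R T,
      B * (Real.log t) ^ x *
        ∫ s in R..t, ∫ r in R..s, r ^ y * (Real.log (r / R)) ^ z * |H r| ^ p ≤ H t) :
    ∀ j : ℕ, ∀ t ∈ Set.Ico (Rs j) T,
      As j * t ^ a * (Real.log t) ^ (-(bs j)) * (Real.log (t / Rs j)) ^ (cs j) ≤ H t := by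
  have hc : 0 ≤ c := c_nonneg_aux A T R a b c hA hR hT H hHc hH1
  have hp1 : 0 < p - 1 := by linarith
  have key : ∀ j : ℕ, (0 < As j ∧ 0 ≤ bs j ∧ x ≤ (p - 1) * bs j ∧ 0 ≤ cs j ∧ R ≤ Rs j) ∧
      ∀ t ∈ Set.Ico (Rs j) T,
      As j * t ^ a * (Real.log t) ^ (-(bs j)) * (Real.log (t / Rs j)) ^ (cs j) ≤ H t := by
    intro j
    induction j with
    | zero =>
      rw [hb0, hc0, hR0, hA0]
      have h1 := (le_max_left _ _).trans hb
      have h2 := (le_max_right _ _).trans hb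
      rw [div_le_iff₀ hp1] at h2
      exact ⟨⟨hA, h1, by linarith, hc, le_rfl⟩, hH1⟩
    | succ j ih =>
      obtain ⟨⟨iA, ib, ix, ic, iR⟩, ih⟩ := ih
      have hε : 0 < (2 : ℝ) ^ (-(j : ℝ)) := by positivity
      rw [hbrec, hcrec, hRrec, hArec]
      refine ⟨⟨?_, ?_, ?_, ?_, ?_⟩, ?_⟩
      · positivity
      · linarith
      · nlinarith
      · positivity
      · nlinarith
      · intro t ht
        exact step_aux B T R a x y z p hB hR hp ha hy hz0 H hHc hH2 _ (Rs j) (As j) (bs j) (cs j)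
          hε iR iA ib ic ih t ht
  exact fun j => (key j).2
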